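/- (Strong normalization) Let R be a polarized rewrite system such that the relations →₋ and →₊ commute and that has a pre-model of R. Then every proof-term π of Γ ⊢_R A in polarized natural deduction modulo R is an element of |A| and, in particular, is strongly normalizable. -/

import Mathlib

/-- Propositional formulas: atoms (indexed by naturals), ⊥, ⇒, ∧, ∨. -/
inductive Form : Type where
  | atom : ℕ → Form
  | bot  : Form
  | imp  : Form → Form → Form
  | and  : Form → Form → Form
  | or   : Form → Form → Form

/-- A polarized rewrite system: a set of negative rules and a set of positive
rules, each rewriting an atomic proposition to an arbitrary formula. -/
structure PRS : Type where
  neg : ℕ → Form → Prop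
  pos : ℕ → Form → Prop

mutual
  /-- One step negative rewriting →₋¹. -/
  inductive Neg1 (R : PRS) : Form → Form → Prop where
    | rule {P A} : R.neg P A → Neg1 R (.atom P) A
    | impL {A A' B} : Pos1 R A A' → Neg1 R (.imp A B) (.imp A' B)
    | impR {A B B'} : Neg1 R B B' → Neg1 R (.imp A B) (.imp A B')
    | andL {A A' B} : Neg1 R A A' → Neg1 R (.and A B) (.and A' B)
    | andR {A B B'} : Neg1 R B B' → Neg1 R (.and A B) (.and A B')
    | orL  {A A' B} : Neg1 R A A' → Neg1 R (.or A B) (.or A' B)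
    | orR  {A B B'} : Neg1 R B B' → Neg1 R (.or A B) (.or A B')
  /-- One step positive rewriting →₊¹. -/
  inductive Pos1 (R : PRS) : Form → Form → Prop where
    | rule {P A} : R.pos P A → Pos1 R (.atom P) A
    | impL {A A' B} : Neg1 R A A' → Pos1 R (.imp A B) (.imp A' B)
    | impR {A B B'} : Pos1 R B B' → Pos1 R (.imp A B) (.imp A B')
    | andL {A A' B} : Pos1 R A A' → Pos1 R (.and A B) (.and A' B)
    | andR {A B B'} : Pos1 R B B' → Pos1 R (.and A B) (.and A B')
    | orL  {A A' B} : Pos1 R A A' → Pos1 R (.or A B) (.or A' B)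
    | orR  {A B B'} : Pos1 R B B' → Pos1 R (.or A B) (.or A B')
end

/-- →₋ : reflexive-transitive closure of →₋¹. -/
def NegR (R : PRS) : Form → Form → Prop := Relation.ReflTransGen (Neg1 R)

/-- →₊ : reflexive-transitive closure of →₊¹. -/
def PosR (R : PRS) : Form → Form → Prop := Relation.ReflTransGen (Pos1 R)

/-- The relations →₋ and →₊ commute. -/
def Commutes (R : PRS) : Prop :=
  ∀ A B C, NegR R B A → PosR R B C → ∃ D, PosR R A D ∧ NegR R C D

/-- Proof-terms (de Bruijn representation of the proof variables). -/
inductive PTerm : Type where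
  | var  : ℕ → PTerm
  | lam  : PTerm → PTerm
  | app  : PTerm → PTerm → PTerm
  | pair : PTerm → PTerm → PTerm
  | fst  : PTerm → PTerm
  | snd  : PTerm → PTerm
  | inl  : PTerm → PTerm
  | inr  : PTerm → PTerm
  | case : PTerm → PTerm → PTerm → PTerm
  | exf  : PTerm → PTerm

/-- Shift by one all de Bruijn indices ≥ c. -/
def liftAbove (c : ℕ) : PTerm → PTerm
  | .var n => if n < c then .var n else .var (n+1)
  | .lam π => .lam (liftAbove (c+1) π)
  | .app a b => .app (liftAbove c a) (liftAbove c b)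
  | .pair a b => .pair (liftAbove c a) (liftAbove c b)
  | .fst a => .fst (liftAbove c a)
  | .snd a => .snd (liftAbove c a)
  | .inl a => .inl (liftAbove c a)
  | .inr a => .inr (liftAbove c a)
  | .case a b c' => .case (liftAbove c a) (liftAbove (c+1) b) (liftAbove (c+1) c')
  | .exf a => .exf (liftAbove c a)

/-- Substitution [u/k]π of the term u for the variable k. -/
def subst (k : ℕ) (u : PTerm) : PTerm → PTerm
  | .var n => if n < k then .var n else if n = k then u else .var (n-1)
  | .lam π => .lam (subst (k+1) (liftAbove 0 u) π)
  | .app a b => .app (subst k u a) (subst k u b)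
  | .pair a b => .pair (subst k u a) (subst k u b)
  | .fst a => .fst (subst k u a)
  | .snd a => .snd (subst k u a)
  | .inl a => .inl (subst k u a)
  | .inr a => .inr (subst k u a)
  | .case a b c => .case (subst k u a) (subst (k+1) (liftAbove 0 u) b) (subst (k+1) (liftAbove 0 u) c)
  | .exf a => .exf (subst k u a)

/-- Typing judgement of polarized natural deduction modulo R:
`Typed R Γ π A` means "π is a proof-term of Γ ⊢_R A".
A context is a finite list of formulas (the declaration of variable n is the
n-th entry of the list). -/
inductive Typed (R : PRS) : List Form → PTerm → Form → Prop where
  | ax {Γ n A B C} : Γ[n]? = some A → NegR R A C → PosR R B C →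
      Typed R Γ (.var n) B
  | impI {Γ π A B C} : Typed R (A :: Γ) π B → PosR R C (.imp A B) →
      Typed R Γ (.lam π) C
  | impE {Γ π₁ π₂ A B C} : Typed R Γ π₁ C → NegR R C (.imp A B) →
      Typed R Γ π₂ A → Typed R Γ (.app π₁ π₂) B
  | andI {Γ π₁ π₂ A B C} : Typed R Γ π₁ A → Typed R Γ π₂ B →
      PosR R C (.and A B) → Typed R Γ (.pair π₁ π₂) C
  | andE₁ {Γ π A B C} : Typed R Γ π C → NegR R C (.and A B) →
      Typed R Γ (.fst π) A
  | andE₂ {Γ π A B C} : Typed R Γ π C → NegR R C (.and A B) →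
      Typed R Γ (.snd π) B
  | orI₁ {Γ π A B C} : Typed R Γ π A → PosR R C (.or A B) →
      Typed R Γ (.inl π) C
  | orI₂ {Γ π A B C} : Typed R Γ π B → PosR R C (.or A B) →
      Typed R Γ (.inr π) C
  | orE {Γ π₁ π₂ π₃ A B C D} : Typed R Γ π₁ D → NegR R D (.or A B) →
      Typed R (A :: Γ) π₂ C → Typed R (B :: Γ) π₃ C →
      Typed R Γ (.case π₁ π₂ π₃) C
  | botE {Γ π A B} : Typed R Γ π B → NegR R B .bot →
      Typed R Γ (.exf π) A

/-- One step proof reduction ▷¹ (contextual closure of the cut elimination rules). -/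
inductive Red1 : PTerm → PTerm → Prop where
  | beta {π₁ π₂} : Red1 (.app (.lam π₁) π₂) (subst 0 π₂ π₁)
  | fstPair {π₁ π₂} : Red1 (.fst (.pair π₁ π₂)) π₁
  | sndPair {π₁ π₂} : Red1 (.snd (.pair π₁ π₂)) π₂
  | caseInl {π₁ π₂ π₃} : Red1 (.case (.inl π₁) π₂ π₃) (subst 0 π₁ π₂)
  | caseInr {π₁ π₂ π₃} : Red1 (.case (.inr π₁) π₂ π₃) (subst 0 π₁ π₃)
  | lam {π π'} : Red1 π π' → Red1 (.lam π) (.lam π')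
  | appL {π π' ρ} : Red1 π π' → Red1 (.app π ρ) (.app π' ρ)
  | appR {π ρ ρ'} : Red1 ρ ρ' → Red1 (.app π ρ) (.app π ρ')
  | pairL {π π' ρ} : Red1 π π' → Red1 (.pair π ρ) (.pair π' ρ)
  | pairR {π ρ ρ'} : Red1 ρ ρ' → Red1 (.pair π ρ) (.pair π ρ')
  | fst {π π'} : Red1 π π' → Red1 (.fst π) (.fst π')
  | snd {π π'} : Red1 π π' → Red1 (.snd π) (.snd π')
  | inl {π π'} : Red1 π π' → Red1 (.inl π) (.inl π')
  | inr {π π'} : Red1 π π' → Red1 (.inr π) (.inr π')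
  | case₁ {π π' ρ τ} : Red1 π π' → Red1 (.case π ρ τ) (.case π' ρ τ)
  | case₂ {π ρ ρ' τ} : Red1 ρ ρ' → Red1 (.case π ρ τ) (.case π ρ' τ)
  | case₃ {π ρ τ τ'} : Red1 τ τ' → Red1 (.case π ρ τ) (.case π ρ τ')
  | exf {π π'} : Red1 π π' → Red1 (.exf π) (.exf π')

/-- ▷ : reflexive-transitive closure of ▷¹. -/
def Red : PTerm → PTerm → Prop := Relation.ReflTransGen Red1

/-- A proof-term is strongly normalizable if every ▷¹-reduction sequence from
it is finite, i.e. it is accessible for the inverse of ▷¹. -/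
def SN (π : PTerm) : Prop := Acc (fun x y => Red1 y x) π

/-- Neutral proof-terms: variables and eliminations, not introductions. -/
def Neutral : PTerm → Prop
  | .var _ => True
  | .app _ _ => True
  | .fst _ => True
  | .snd _ => True
  | .case _ _ _ => True
  | .exf _ => True
  | _ => False

/-- Reducibility candidates. -/
structure IsCandidate (S : Set PTerm) : Prop where
  sn : ∀ π ∈ S, SN π
  closed : ∀ π ∈ S, ∀ π', Red π π' → π' ∈ S
  neutral : ∀ π, Neutral π → (∀ π', Red1 π π' → π' ∈ S) → π ∈ S

/-- A pre-model is an assignment of a reducibility candidate to each atom. -/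
def IsPreModel (M : ℕ → Set PTerm) : Prop := ∀ P, IsCandidate (M P)

/-- The interpretation |A| of a formula in a pre-model. -/
def interp (M : ℕ → Set PTerm) : Form → Set PTerm
  | .atom P => M P
  | .bot => {π | SN π}
  | .imp A B => {π | SN π ∧ ∀ π₁, Red π (.lam π₁) →
      ∀ π' ∈ interp M A, subst 0 π' π₁ ∈ interp M B}
  | .and A B => {π | SN π ∧ ∀ π₁ π₂, Red π (.pair π₁ π₂) →
      π₁ ∈ interp M A ∧ π₂ ∈ interp M B}
  | .or A B => {π | SN π ∧ (∀ π₁, Red π (.inl π₁) → π₁ ∈ interp M A) ∧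
      (∀ π₂, Red π (.inr π₂) → π₂ ∈ interp M B)}

/-- A pre-model of a polarized rewrite system R. -/
def IsPreModelOf (R : PRS) (M : ℕ → Set PTerm) : Prop :=
  IsPreModel M ∧
  (∀ P A, R.neg P A → interp M (.atom P) ⊆ interp M A) ∧
  (∀ P A, R.pos P A → interp M A ⊆ interp M (.atom P))

/-! ### Parallel renamings and substitutions -/

/-- Lift a renaming under a binder. -/
def upRen (ξ : ℕ → ℕ) : ℕ → ℕ
  | 0 => 0
  | n + 1 => ξ n + 1

/-- Parallel renaming of proof variables. -/
def PTerm.ren : (ℕ → ℕ) → PTerm → PTerm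
  | ξ, .var n => .var (ξ n)
  | ξ, .lam a => .lam (ren (upRen ξ) a)
  | ξ, .app a b => .app (ren ξ a) (ren ξ b)
  | ξ, .pair a b => .pair (ren ξ a) (ren ξ b)
  | ξ, .fst a => .fst (ren ξ a)
  | ξ, .snd a => .snd (ren ξ a)
  | ξ, .inl a => .inl (ren ξ a)
  | ξ, .inr a => .inr (ren ξ a)
  | ξ, .case a b c => .case (ren ξ a) (ren (upRen ξ) b) (ren (upRen ξ) c)
  | ξ, .exf a => .exf (ren ξ a)

/-- Extend a parallel substitution by a term for the variable `0`. -/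
def scons (u : PTerm) (σ : ℕ → PTerm) : ℕ → PTerm
  | 0 => u
  | n + 1 => σ n

/-- Lift a parallel substitution under a binder. -/
def upSub (σ : ℕ → PTerm) : ℕ → PTerm :=
  scons (.var 0) fun n => (σ n).ren Nat.succ

/-- Parallel substitution of proof variables. -/
def PTerm.sub : (ℕ → PTerm) → PTerm → PTerm
  | σ, .var n => σ n
  | σ, .lam a => .lam (sub (upSub σ) a)
  | σ, .app a b => .app (sub σ a) (sub σ b)
  | σ, .pair a b => .pair (sub σ a) (sub σ b)
  | σ, .fst a => .fst (sub σ a)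
  | σ, .snd a => .snd (sub σ a)
  | σ, .inl a => .inl (sub σ a)
  | σ, .inr a => .inr (sub σ a)
  | σ, .case a b c => .case (sub σ a) (sub (upSub σ) b) (sub (upSub σ) c)
  | σ, .exf a => .exf (sub σ a)

theorem upRen_comp (ξ ζ : ℕ → ℕ) : upRen ξ ∘ upRen ζ = upRen (ξ ∘ ζ) := by
  funext n
  cases n <;> rfl

theorem PTerm.ren_ren (t : PTerm) (ξ ζ : ℕ → ℕ) : (t.ren ζ).ren ξ = t.ren (ξ ∘ ζ) := by
  induction t generalizing ξ ζ <;> simp [PTerm.ren, upRen_comp, *]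

theorem upSub_comp_upRen (σ : ℕ → PTerm) (ξ : ℕ → ℕ) :
    upSub σ ∘ upRen ξ = upSub (σ ∘ ξ) := by
  funext n
  cases n <;> rfl

theorem PTerm.sub_ren (t : PTerm) (σ : ℕ → PTerm) (ξ : ℕ → ℕ) :
    (t.ren ξ).sub σ = t.sub (σ ∘ ξ) := by
  induction t generalizing σ ξ <;> simp [PTerm.ren, PTerm.sub, upSub_comp_upRen, *]

theorem ren_comp_upSub (ξ : ℕ → ℕ) (σ : ℕ → PTerm) :
    (fun n => (upSub σ n).ren (upRen ξ)) = upSub fun n => (σ n).ren ξ := by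
  funext n
  cases n with
  | zero => rfl
  | succ n =>
    simp only [upSub, scons, PTerm.ren_ren]
    rfl

theorem PTerm.ren_sub (t : PTerm) (ξ : ℕ → ℕ) (σ : ℕ → PTerm) :
    (t.sub σ).ren ξ = t.sub fun n => (σ n).ren ξ := by
  induction t generalizing σ ξ <;> simp [PTerm.ren, PTerm.sub, ren_comp_upSub, *]

theorem sub_comp_upSub (τ σ : ℕ → PTerm) :
    (fun n => (upSub σ n).sub (upSub τ)) = upSub fun n => (σ n).sub τ := by
  funext n
  cases n with
  | zero => rfl
  | succ n =>
    simp only [upSub, scons, PTerm.sub_ren, PTerm.ren_sub]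
    rfl

theorem PTerm.sub_sub (t : PTerm) (τ σ : ℕ → PTerm) :
    (t.sub σ).sub τ = t.sub fun n => (σ n).sub τ := by
  induction t generalizing σ τ <;> simp [PTerm.sub, sub_comp_upSub, *]

theorem upSub_var : upSub PTerm.var = PTerm.var := by
  funext n
  cases n <;> rfl

theorem PTerm.sub_var (t : PTerm) : t.sub .var = t := by
  induction t <;> simp [PTerm.sub, upSub_var, *]

theorem upRen_shift (c : ℕ) :
    upRen (fun n => if n < c then n else n + 1) = fun n => if n < c + 1 then n else n + 1 := by
  funext n
  cases n with
  | zero => simp [upRen]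
  | succ n =>
    simp only [upRen]
    split_ifs <;> omega

theorem liftAbove_eq_ren (c : ℕ) (t : PTerm) :
    liftAbove c t = t.ren fun n => if n < c then n else n + 1 := by
  induction t generalizing c with
  | var n =>
    simp only [liftAbove, PTerm.ren]
    split_ifs <;> rfl
  | _ => simp [liftAbove, PTerm.ren, upRen_shift, *]

theorem liftAbove_zero (t : PTerm) : liftAbove 0 t = t.ren Nat.succ := by
  rw [liftAbove_eq_ren]
  rfl

theorem upSub_single (k : ℕ) (u : PTerm) :
    upSub (fun n => if n < k then .var n else if n = k then u else .var (n - 1)) =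
      fun n => if n < k + 1 then .var n else if n = k + 1 then u.ren Nat.succ
        else .var (n - 1) := by
  funext n
  cases n with
  | zero => simp [upSub, scons]
  | succ n =>
    simp only [upSub, scons, Nat.add_lt_add_iff_right, Nat.add_right_cancel_iff]
    split_ifs with h₁ h₂
    · rfl
    · rfl
    · simp only [PTerm.ren, PTerm.var.injEq]
      omega

theorem subst_eq_sub (k : ℕ) (u t : PTerm) :
    subst k u t =
      t.sub fun n => if n < k then .var n else if n = k then u else .var (n - 1) := by
  induction t generalizing k u with
  | var n => rfl
  | _ => simp [subst, PTerm.sub, upSub_single, liftAbove_zero, *]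

theorem subst_zero (u t : PTerm) : subst 0 u t = t.sub (scons u .var) := by
  rw [subst_eq_sub]
  congr 1
  funext n
  cases n <;> simp [scons]

theorem subst_zero_sub_upSub (u t : PTerm) (σ : ℕ → PTerm) :
    subst 0 u (t.sub (upSub σ)) = t.sub (scons u σ) := by
  rw [subst_zero, PTerm.sub_sub]
  congr 1
  funext n
  cases n with
  | zero => rfl
  | succ n =>
    simp only [upSub, scons, PTerm.sub_ren]
    exact PTerm.sub_var _

theorem sub_subst_zero (u t : PTerm) (σ : ℕ → PTerm) :
    (subst 0 u t).sub σ = subst 0 (u.sub σ) (t.sub (upSub σ)) := by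
  rw [subst_zero_sub_upSub, subst_zero, PTerm.sub_sub]
  congr 1
  funext n
  cases n <;> rfl

/-! ### Reduction and strong normalization -/

theorem Red1.sub {t t' : PTerm} (h : Red1 t t') (σ : ℕ → PTerm) :
    Red1 (t.sub σ) (t'.sub σ) := by
  induction h generalizing σ with
  | beta => rw [sub_subst_zero]; exact .beta
  | fstPair => exact .fstPair
  | sndPair => exact .sndPair
  | caseInl => rw [sub_subst_zero]; exact .caseInl
  | caseInr => rw [sub_subst_zero]; exact .caseInr
  | lam _ ih => exact .lam (ih _)
  | appL _ ih => exact .appL (ih _)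
  | appR _ ih => exact .appR (ih _)
  | pairL _ ih => exact .pairL (ih _)
  | pairR _ ih => exact .pairR (ih _)
  | fst _ ih => exact .fst (ih _)
  | snd _ ih => exact .snd (ih _)
  | inl _ ih => exact .inl (ih _)
  | inr _ ih => exact .inr (ih _)
  | case₁ _ ih => exact .case₁ (ih _)
  | case₂ _ ih => exact .case₂ (ih _)
  | case₃ _ ih => exact .case₃ (ih _)
  | exf _ ih => exact .exf (ih _)

theorem Red1.subst_zero {t t' : PTerm} (h : Red1 t t') (u : PTerm) :
    Red1 (subst 0 u t) (subst 0 u t') := by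
  rw [_root_.subst_zero, _root_.subst_zero]
  exact h.sub _

theorem Red.subst_zero {t t' : PTerm} (h : Red t t') (u : PTerm) :
    Red (subst 0 u t) (subst 0 u t') := by
  induction h with
  | refl => exact .refl
  | tail _ hr ih => exact ih.tail (hr.subst_zero u)

theorem SN.red1 {t t' : PTerm} (h : SN t) (hr : Red1 t t') : SN t' :=
  Acc.inv h hr

theorem SN.red {t t' : PTerm} (h : SN t) (hr : Red t t') : SN t' := by
  induction hr with
  | refl => exact h
  | tail _ hr ih => exact ih.red1 hr

theorem SN.of_map {f : PTerm → PTerm} (hf : ∀ {t t'}, Red1 t t' → Red1 (f t) (f t'))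
    {t : PTerm} (h : SN (f t)) : SN t :=
  Subrelation.accessible (fun h => hf h) (InvImage.accessible f h)

theorem SN.of_subst_zero {u t : PTerm} (h : SN (subst 0 u t)) : SN t :=
  SN.of_map (fun hr => Red1.subst_zero hr u) h

theorem SN.lam {t : PTerm} (h : SN t) : SN t.lam := by
  induction h with
  | intro t _ ih =>
    refine ⟨_, fun s hs => ?_⟩
    cases hs with
    | lam hr => exact ih _ hr

theorem SN.inl {t : PTerm} (h : SN t) : SN t.inl := by
  induction h with
  | intro t _ ih =>
    refine ⟨_, fun s hs => ?_⟩
    cases hs with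
    | inl hr => exact ih _ hr

theorem SN.inr {t : PTerm} (h : SN t) : SN t.inr := by
  induction h with
  | intro t _ ih =>
    refine ⟨_, fun s hs => ?_⟩
    cases hs with
    | inr hr => exact ih _ hr

theorem SN.pair {a b : PTerm} (ha : SN a) (hb : SN b) : SN (a.pair b) := by
  induction ha generalizing b with
  | intro a _ iha =>
    induction hb with
    | intro b hb ihb =>
      refine ⟨_, fun s hs => ?_⟩
      cases hs with
      | pairL hr => exact iha _ hr ⟨_, hb⟩
      | pairR hr => exact ihb _ hr

theorem Red.of_lam {a s : PTerm} (h : Red a.lam s) : ∃ a', s = a'.lam ∧ Red a a' := by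
  induction h with
  | refl => exact ⟨a, rfl, .refl⟩
  | tail _ hr ih =>
    obtain ⟨a', rfl, ha⟩ := ih
    cases hr with
    | lam hr => exact ⟨_, rfl, ha.tail hr⟩

theorem Red.of_inl {a s : PTerm} (h : Red a.inl s) : ∃ a', s = a'.inl ∧ Red a a' := by
  induction h with
  | refl => exact ⟨a, rfl, .refl⟩
  | tail _ hr ih =>
    obtain ⟨a', rfl, ha⟩ := ih
    cases hr with
    | inl hr => exact ⟨_, rfl, ha.tail hr⟩

theorem Red.of_inr {a s : PTerm} (h : Red a.inr s) : ∃ a', s = a'.inr ∧ Red a a' := by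
  induction h with
  | refl => exact ⟨a, rfl, .refl⟩
  | tail _ hr ih =>
    obtain ⟨a', rfl, ha⟩ := ih
    cases hr with
    | inr hr => exact ⟨_, rfl, ha.tail hr⟩

theorem Red.of_pair {a b s : PTerm} (h : Red (a.pair b) s) :
    ∃ a' b', s = a'.pair b' ∧ Red a a' ∧ Red b b' := by
  induction h with
  | refl => exact ⟨a, b, rfl, .refl, .refl⟩
  | tail _ hr ih =>
    obtain ⟨a', b', rfl, ha, hb⟩ := ih
    cases hr with
    | pairL hr => exact ⟨_, _, rfl, ha.tail hr, hb⟩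
    | pairR hr => exact ⟨_, _, rfl, ha, hb.tail hr⟩

/-! ### Reducibility candidates -/

theorem IsCandidate.red1 {S : Set PTerm} (hS : IsCandidate S) {t t' : PTerm} (ht : t ∈ S)
    (hr : Red1 t t') : t' ∈ S :=
  hS.closed t ht t' (.single hr)

theorem IsCandidate.var_mem {S : Set PTerm} (hS : IsCandidate S) (n : ℕ) : .var n ∈ S :=
  hS.neutral _ trivial fun _ h => nomatch h

/-- A reduction from a neutral term to an introduction takes at least one step. -/
theorem Neutral.exists_red1 {t s : PTerm} (ht : Neutral t) (hs : ¬ Neutral s) (h : Red t s) :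
    ∃ t', Red1 t t' ∧ Red t' s := by
  rcases Relation.ReflTransGen.cases_head h with rfl | h
  · exact absurd ht hs
  · exact h

theorem isCandidate_interp {M : ℕ → Set PTerm} (hM : IsPreModel M) (A : Form) :
    IsCandidate (interp M A) := by
  induction A with
  | atom P => exact hM P
  | bot => exact ⟨fun _ h => h, fun _ h _ hr => SN.red h hr, fun _ _ h => ⟨_, h⟩⟩
  | imp A B _ _ =>
    refine ⟨fun _ h => h.1, fun _ h _ hr => ⟨h.1.red hr, fun a ha => h.2 a (hr.trans ha)⟩,
      fun t ht h => ⟨⟨_, fun s hs => (h s hs).1⟩, fun a ha => ?_⟩⟩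
    obtain ⟨s, hs, hr⟩ := ht.exists_red1 id ha
    exact (h s hs).2 a hr
  | and A B _ _ =>
    refine ⟨fun _ h => h.1, fun _ h _ hr => ⟨h.1.red hr, fun a b hab => h.2 a b (hr.trans hab)⟩,
      fun t ht h => ⟨⟨_, fun s hs => (h s hs).1⟩, fun a b hab => ?_⟩⟩
    obtain ⟨s, hs, hr⟩ := ht.exists_red1 id hab
    exact (h s hs).2 a b hr
  | or A B _ _ =>
    refine ⟨fun _ h => h.1, fun _ h _ hr => ⟨h.1.red hr, fun a ha => h.2.1 a (hr.trans ha),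
      fun b hb => h.2.2 b (hr.trans hb)⟩,
      fun t ht h => ⟨⟨_, fun s hs => (h s hs).1⟩, fun a ha => ?_, fun b hb => ?_⟩⟩
    · obtain ⟨s, hs, hr⟩ := ht.exists_red1 id ha
      exact (h s hs).2.1 a hr
    · obtain ⟨s, hs, hr⟩ := ht.exists_red1 id hb
      exact (h s hs).2.2 b hr

section Adequacy

variable {M : ℕ → Set PTerm} {A B C : Form}

theorem lam_mem_interp (hM : IsPreModel M) {t : PTerm}
    (h : ∀ u ∈ interp M A, subst 0 u t ∈ interp M B) : t.lam ∈ interp M (.imp A B) := by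
  have ht : SN t := SN.of_subst_zero
    ((isCandidate_interp hM B).sn _ (h _ ((isCandidate_interp hM A).var_mem 0)))
  refine ⟨ht.lam, fun s hs u hu => ?_⟩
  obtain ⟨s', hss, hr⟩ := hs.of_lam
  cases hss
  exact (isCandidate_interp hM B).closed _ (h u hu) _ (hr.subst_zero u)

theorem app_mem_interp (hM : IsPreModel M) {a b : PTerm} (ha : a ∈ interp M (.imp A B))
    (hb : b ∈ interp M A) : a.app b ∈ interp M B := by
  have sa := (isCandidate_interp hM _).sn a ha
  have sb := (isCandidate_interp hM _).sn b hb
  induction sa generalizing b with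
  | intro a _ iha =>
    induction sb with
    | intro b hsb ihb =>
      refine (isCandidate_interp hM B).neutral _ trivial fun s hs => ?_
      cases hs with
      | beta => exact ha.2 _ .refl _ hb
      | appL hr => exact iha _ hr ((isCandidate_interp hM _).red1 ha hr) hb ⟨_, hsb⟩
      | appR hr => exact ihb _ hr ((isCandidate_interp hM _).red1 hb hr)

theorem pair_mem_interp (hM : IsPreModel M) {a b : PTerm} (ha : a ∈ interp M A)
    (hb : b ∈ interp M B) : a.pair b ∈ interp M (.and A B) := by
  have cA := isCandidate_interp hM A
  have cB := isCandidate_interp hM B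
  refine ⟨(cA.sn a ha).pair (cB.sn b hb), fun a' b' h => ?_⟩
  obtain ⟨_, _, hs, hra, hrb⟩ := h.of_pair
  cases hs
  exact ⟨cA.closed _ ha _ hra, cB.closed _ hb _ hrb⟩

theorem fst_mem_interp (hM : IsPreModel M) {a : PTerm} (ha : a ∈ interp M (.and A B)) :
    a.fst ∈ interp M A := by
  have sa := (isCandidate_interp hM _).sn a ha
  induction sa with
  | intro a _ ih =>
    refine (isCandidate_interp hM A).neutral _ trivial fun s hs => ?_
    cases hs with
    | fstPair => exact (ha.2 _ _ .refl).1
    | fst hr => exact ih _ hr ((isCandidate_interp hM _).red1 ha hr)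

theorem snd_mem_interp (hM : IsPreModel M) {a : PTerm} (ha : a ∈ interp M (.and A B)) :
    a.snd ∈ interp M B := by
  have sa := (isCandidate_interp hM _).sn a ha
  induction sa with
  | intro a _ ih =>
    refine (isCandidate_interp hM B).neutral _ trivial fun s hs => ?_
    cases hs with
    | sndPair => exact (ha.2 _ _ .refl).2
    | snd hr => exact ih _ hr ((isCandidate_interp hM _).red1 ha hr)

theorem inl_mem_interp (hM : IsPreModel M) {a : PTerm} (ha : a ∈ interp M A) :
    a.inl ∈ interp M (.or A B) := by
  have cA := isCandidate_interp hM A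
  refine ⟨(cA.sn a ha).inl, fun s h => ?_, fun s h => ?_⟩ <;>
    obtain ⟨_, hs, hr⟩ := h.of_inl <;> cases hs
  exact cA.closed _ ha _ hr

theorem inr_mem_interp (hM : IsPreModel M) {b : PTerm} (hb : b ∈ interp M B) :
    b.inr ∈ interp M (.or A B) := by
  have cB := isCandidate_interp hM B
  refine ⟨(cB.sn b hb).inr, fun s h => ?_, fun s h => ?_⟩ <;>
    obtain ⟨_, hs, hr⟩ := h.of_inr <;> cases hs
  exact cB.closed _ hb _ hr

theorem case_mem_interp (hM : IsPreModel M) {a b c : PTerm} (ha : a ∈ interp M (.or A B))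
    (hb : ∀ u ∈ interp M A, subst 0 u b ∈ interp M C)
    (hc : ∀ u ∈ interp M B, subst 0 u c ∈ interp M C) : a.case b c ∈ interp M C := by
  have cC := isCandidate_interp hM C
  have sa := (isCandidate_interp hM _).sn a ha
  have sb : SN b := SN.of_subst_zero
    (cC.sn _ (hb _ ((isCandidate_interp hM A).var_mem 0)))
  have sc : SN c := SN.of_subst_zero
    (cC.sn _ (hc _ ((isCandidate_interp hM B).var_mem 0)))
  induction sa generalizing b c with
  | intro a _ iha =>
    induction sb generalizing c with
    | intro b hsb ihb =>
      induction sc with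
      | intro c hsc ihc =>
        refine cC.neutral _ trivial fun s hs => ?_
        cases hs with
        | caseInl => exact hb _ (ha.2.1 _ .refl)
        | caseInr => exact hc _ (ha.2.2 _ .refl)
        | case₁ hr =>
          exact iha _ hr ((isCandidate_interp hM _).red1 ha hr) hb hc ⟨_, hsb⟩ ⟨_, hsc⟩
        | case₂ hr =>
          exact ihb _ hr (fun u hu => cC.red1 (hb u hu) (hr.subst_zero u)) hc ⟨_, hsc⟩
        | case₃ hr => exact ihc _ hr fun u hu => cC.red1 (hc u hu) (hr.subst_zero u)

theorem exf_mem_interp (hM : IsPreModel M) {a : PTerm} (ha : a ∈ interp M .bot) :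
    a.exf ∈ interp M A := by
  have sa : SN a := ha
  clear ha
  induction sa with
  | intro a _ ih =>
    refine (isCandidate_interp hM A).neutral _ trivial fun s hs => ?_
    cases hs with
    | exf hr => exact ih _ hr

theorem interp_imp_mono {A' B' : Form} (hA : interp M A' ⊆ interp M A)
    (hB : interp M B ⊆ interp M B') : interp M (.imp A B) ⊆ interp M (.imp A' B') :=
  fun _ h => ⟨h.1, fun a ha u hu => hB (h.2 a ha u (hA hu))⟩

theorem interp_and_mono {A' B' : Form} (hA : interp M A ⊆ interp M A')
    (hB : interp M B ⊆ interp M B') : interp M (.and A B) ⊆ interp M (.and A' B') :=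
  fun _ h => ⟨h.1, fun a b hab => ⟨hA (h.2 a b hab).1, hB (h.2 a b hab).2⟩⟩

theorem interp_or_mono {A' B' : Form} (hA : interp M A ⊆ interp M A')
    (hB : interp M B ⊆ interp M B') : interp M (.or A B) ⊆ interp M (.or A' B') :=
  fun _ h => ⟨h.1, fun a ha => hA (h.2.1 a ha), fun b hb => hB (h.2.2 b hb)⟩

end Adequacy

mutual

theorem Neg1.interp_subset {R : PRS} {M : ℕ → Set PTerm} (hM : IsPreModelOf R M) {A B : Form} :
    Neg1 R A B → interp M A ⊆ interp M B
  | .rule h => hM.2.1 _ _ h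
  | .impL h => interp_imp_mono (h.interp_subset hM) subset_rfl
  | .impR h => interp_imp_mono subset_rfl (h.interp_subset hM)
  | .andL h => interp_and_mono (h.interp_subset hM) subset_rfl
  | .andR h => interp_and_mono subset_rfl (h.interp_subset hM)
  | .orL h => interp_or_mono (h.interp_subset hM) subset_rfl
  | .orR h => interp_or_mono subset_rfl (h.interp_subset hM)

theorem Pos1.interp_subset {R : PRS} {M : ℕ → Set PTerm} (hM : IsPreModelOf R M) {A B : Form} :
    Pos1 R A B → interp M B ⊆ interp M A
  | .rule h => hM.2.2 _ _ h
  | .impL h => interp_imp_mono (h.interp_subset hM) subset_rfl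
  | .impR h => interp_imp_mono subset_rfl (h.interp_subset hM)
  | .andL h => interp_and_mono (h.interp_subset hM) subset_rfl
  | .andR h => interp_and_mono subset_rfl (h.interp_subset hM)
  | .orL h => interp_or_mono (h.interp_subset hM) subset_rfl
  | .orR h => interp_or_mono subset_rfl (h.interp_subset hM)

end

theorem NegR.interp_subset {R : PRS} {M : ℕ → Set PTerm} (hM : IsPreModelOf R M) {A B : Form}
    (h : NegR R A B) : interp M A ⊆ interp M B := by
  induction h with
  | refl => exact subset_rfl
  | tail _ h ih => exact ih.trans (h.interp_subset hM)

theorem PosR.interp_subset {R : PRS} {M : ℕ → Set PTerm} (hM : IsPreModelOf R M) {A B : Form}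
    (h : PosR R A B) : interp M B ⊆ interp M A := by
  induction h with
  | refl => exact subset_rfl
  | tail _ h ih => exact (h.interp_subset hM).trans ih

/-- `σ` maps every variable declared in `Γ` into the interpretation of its formula. -/
def SubstMem (M : ℕ → Set PTerm) (Γ : List Form) (σ : ℕ → PTerm) : Prop :=
  ∀ n A, Γ[n]? = some A → σ n ∈ interp M A

theorem SubstMem.scons {M : ℕ → Set PTerm} {Γ : List Form} {σ : ℕ → PTerm}
    (hσ : SubstMem M Γ σ) {A : Form} {u : PTerm} (hu : u ∈ interp M A) :
    SubstMem M (A :: Γ) (scons u σ)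
  | 0, B, h => by
    cases h
    exact hu
  | n + 1, B, h => hσ n B (by simpa using h)

theorem Typed.sub_mem_interp {R : PRS} {M : ℕ → Set PTerm} (hM : IsPreModelOf R M)
    {Γ : List Form} {π : PTerm} {A : Form} (h : Typed R Γ π A) {σ : ℕ → PTerm}
    (hσ : SubstMem M Γ σ) : π.sub σ ∈ interp M A := by
  have instantiate {Γ : List Form} {π : PTerm} {A B : Form} {σ : ℕ → PTerm}
      (ih : ∀ {σ}, SubstMem M (A :: Γ) σ → π.sub σ ∈ interp M B)
      (hσ : SubstMem M Γ σ) : ∀ u ∈ interp M A, subst 0 u (π.sub (upSub σ)) ∈ interp M B :=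
    fun u hu => subst_zero_sub_upSub u π σ ▸ ih (hσ.scons hu)
  induction h generalizing σ with
  | ax hn hA hB => exact hB.interp_subset hM (hA.interp_subset hM (hσ _ _ hn))
  | impI _ hC ih => exact hC.interp_subset hM (lam_mem_interp hM.1 (instantiate ih hσ))
  | impE _ hC _ ih₁ ih₂ => exact app_mem_interp hM.1 (hC.interp_subset hM (ih₁ hσ)) (ih₂ hσ)
  | andI _ _ hC ih₁ ih₂ => exact hC.interp_subset hM (pair_mem_interp hM.1 (ih₁ hσ) (ih₂ hσ))
  | andE₁ _ hC ih => exact fst_mem_interp hM.1 (hC.interp_subset hM (ih hσ))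
  | andE₂ _ hC ih => exact snd_mem_interp hM.1 (hC.interp_subset hM (ih hσ))
  | orI₁ _ hC ih => exact hC.interp_subset hM (inl_mem_interp hM.1 (ih hσ))
  | orI₂ _ hC ih => exact hC.interp_subset hM (inr_mem_interp hM.1 (ih hσ))
  | orE _ hD _ _ ih₁ ih₂ ih₃ =>
    exact case_mem_interp hM.1 (hD.interp_subset hM (ih₁ hσ)) (instantiate ih₂ hσ)
      (instantiate ih₃ hσ)
  | botE _ hB ih => exact exf_mem_interp hM.1 (hB.interp_subset hM (ih hσ))

/-- Strong normalization: if →₋ and →₊ commute and M is a pre-model of R, then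
every proof-term of Γ ⊢_R A is in |A|, and in particular strongly normalizable. -/
theorem strong_normalization (R : PRS) (hcomm : Commutes R)
    (M : ℕ → Set PTerm) (hM : IsPreModelOf R M)
    (Γ : List Form) (π : PTerm) (A : Form)
    (h : Typed R Γ π A) :
    π ∈ interp M A ∧ SN π := by
  have hπ : π.sub .var ∈ interp M A :=
    h.sub_mem_interp hM fun n B _ => (isCandidate_interp hM.1 B).var_mem n
  rw [PTerm.sub_var] at hπ
  exact ⟨hπ, (isCandidate_interp hM.1 A).sn π hπ⟩
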